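/- arXiv:2308.15460 — 2 statements merged into one kernel-verified Lean document; each statement's English description precedes it below -/
import Mathlib

section
/- Let 0 < λ ≤ 1, d_+ = (1+√λ)², d_− = (1−√λ)², and p the Marčenko–Pastur density. Then ∫_{d_−}^{d_+} log(d_+ − x) p(x) dx = (1 − λ^{-1}) log(1 + √λ) + log √λ + λ^{-1/2}. -/
open Real

open MeasureTheory in
theorem integral_zero_pi_of_reflection_symm {k : ℝ → ℝ} (hk : ∀ t, k (2 * π - t) = k t)
    (hint : IntervalIntegrable k volume 0 (2 * π)) :
    ∫ t in 0..π, k t = (∫ t in 0..(2 * π), k t) / 2 := by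
  have hpi := pi_pos
  have hleft : IntervalIntegrable k volume 0 π := hint.mono_set (by
    rw [Set.uIcc_of_le hpi.le, Set.uIcc_of_le (by linarith)]
    exact Set.Icc_subset_Icc le_rfl (by linarith))
  have hright : IntervalIntegrable k volume π (2 * π) := hint.mono_set (by
    rw [Set.uIcc_of_le (by linarith), Set.uIcc_of_le (by linarith)]
    exact Set.Icc_subset_Icc hpi.le le_rfl)
  have hrefl : ∫ t in π..(2 * π), k t = ∫ t in 0..π, k t := by
    have h := intervalIntegral.integral_comp_sub_left (a := 0) (b := π) k (2 * π)
    simp only [hk] at h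
    rw [h]
    congr 1 <;> ring
  rw [← intervalIntegral.integral_add_adjacent_intervals hleft hright, hrefl]
  ring

theorem norm_circleMap_sub_ofReal_sq (a t : ℝ) :
    ‖circleMap 0 1 t - (a : ℂ)‖ ^ 2 = 1 + a ^ 2 - 2 * a * cos t := by
  rw [← Complex.normSq_eq_norm_sq, Complex.normSq_apply]
  simp [circleMap, Complex.exp_ofReal_mul_I_re, Complex.exp_ofReal_mul_I_im]
  nlinarith [sin_sq_add_cos_sq t]

theorem log_two_sub_two_mul_cos (t : ℝ) :
    log (2 - 2 * cos t) = 2 * log ‖circleMap 0 1 t - 1‖ := by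
  have h := norm_circleMap_sub_ofReal_sq 1 t
  rw [Complex.ofReal_one] at h
  rw [← Nat.cast_ofNat (R := ℝ) (n := 2), ← log_pow, h]
  congr 1
  push_cast
  ring

open MeasureTheory in
theorem intervalIntegrable_log_two_sub_two_mul_cos :
    IntervalIntegrable (fun t ↦ log (2 - 2 * cos t)) volume 0 (2 * π) := by
  simp only [log_two_sub_two_mul_cos]
  exact (circleIntegrable_log_norm_sub_const (a := 1) (c := 0) 1).const_mul 2

theorem one_add_sq_add_two_mul_mul_cos_pos {s : ℝ} (hs0 : 0 ≤ s) (hs1 : s < 1) (t : ℝ) :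
    0 < 1 + s ^ 2 + 2 * s * cos t := by
  nlinarith [neg_one_le_cos t, mul_nonneg hs0 (by linarith [neg_one_le_cos t] : 0 ≤ cos t + 1)]

theorem continuous_poisson_cos {s : ℝ} (hs0 : 0 ≤ s) (hs1 : s < 1) :
    Continuous fun t ↦ (1 - s ^ 2) / (1 + s ^ 2 + 2 * s * cos t) :=
  Continuous.div (by fun_prop) (by fun_prop)
    fun t ↦ (one_add_sq_add_two_mul_mul_cos_pos hs0 hs1 t).ne'

theorem re_herglotzRieszKernel_circleMap_neg (s t : ℝ) :
    (Complex.re ∘ herglotzRieszKernel 0 (-s : ℂ)) (circleMap 0 1 t)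
      = (1 - s ^ 2) / (1 + s ^ 2 + 2 * s * cos t) := by
  have h := norm_circleMap_sub_ofReal_sq (-s) t
  rw [← poissonKernel_eq_re_herglotzRieszKernel, poissonKernel_def, sub_zero, sub_zero,
    ← Complex.ofReal_neg, h]
  simp

theorem integral_poisson_cos {s : ℝ} (hs0 : 0 ≤ s) (hs1 : s < 1) :
    ∫ t in 0..π, (1 - s ^ 2) / (1 + s ^ 2 + 2 * s * cos t) = π := by
  rw [integral_zero_pi_of_reflection_symm (fun t ↦ by simp [cos_two_pi_sub])
    ((continuous_poisson_cos hs0 hs1).intervalIntegrable _ _)]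
  have hw : (-s : ℂ) ∈ Metric.ball (0 : ℂ) 1 := by simpa [abs_of_nonneg hs0] using hs1
  have hf : InnerProductSpace.HarmonicOnNhd (fun _ : ℂ ↦ (1 : ℝ)) (Metric.closedBall 0 1) :=
    InnerProductSpace.harmonicOnNhd_const 1
  have h := hf.circleAverage_re_herglotzRieszKernel_smul hw
  rw [circleAverage_def, smul_eq_mul] at h
  simp only [Pi.smul_apply', re_herglotzRieszKernel_circleMap_neg, smul_eq_mul, mul_one] at h
  rw [inv_mul_eq_one₀ (by positivity)] at h
  rw [← h]
  ring

theorem integral_log_mul_poisson_cos {s : ℝ} (hs0 : 0 ≤ s) (hs1 : s < 1) :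
    ∫ t in 0..π, log (2 - 2 * cos t) * ((1 - s ^ 2) / (1 + s ^ 2 + 2 * s * cos t))
      = 2 * π * log (1 + s) := by
  have hw : (-s : ℂ) ∈ Metric.ball (0 : ℂ) 1 := by simpa [abs_of_nonneg hs0] using hs1
  have hρ : (1 : ℂ) ∈ Metric.sphere (0 : ℂ) 1 := by simp
  have h := circleAverage_re_herglotzRieszKernel_mul_log hρ hw
  have hnorm : ‖(-s : ℂ) - 1‖ = 1 + s := by
    rw [← norm_neg, show -((-s : ℂ) - 1) = ((1 + s : ℝ) : ℂ) by push_cast; ring,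
      Complex.norm_real, norm_of_nonneg (by linarith)]
  rw [hnorm, circleAverage_def, smul_eq_mul] at h
  simp only [Pi.mul_apply, re_herglotzRieszKernel_circleMap_neg] at h
  rw [integral_zero_pi_of_reflection_symm (fun t ↦ by simp [cos_two_pi_sub])
    (intervalIntegrable_log_two_sub_two_mul_cos.mul_continuousOn
      (continuous_poisson_cos hs0 hs1).continuousOn)]
  have heq : ∀ t, log (2 - 2 * cos t) * ((1 - s ^ 2) / (1 + s ^ 2 + 2 * s * cos t))
      = 2 * ((1 - s ^ 2) / (1 + s ^ 2 + 2 * s * cos t) * log ‖circleMap 0 1 t - 1‖) := by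
    intro t
    rw [log_two_sub_two_mul_cos]
    ring
  simp only [heq]
  rw [intervalIntegral.integral_const_mul, ← h]
  field_simp

theorem integral_log_two_sub_two_mul_cos : ∫ t in 0..π, log (2 - 2 * cos t) = 0 := by
  simpa using integral_log_mul_poisson_cos le_rfl zero_lt_one

open MeasureTheory in
theorem intervalIntegrable_log_two_sub_two_mul_cos_zero_pi :
    IntervalIntegrable (fun t ↦ log (2 - 2 * cos t)) volume 0 π :=
  intervalIntegrable_log_two_sub_two_mul_cos.mono_set (by
    rw [Set.uIcc_of_le pi_pos.le, Set.uIcc_of_le (by linarith [pi_pos])]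
    exact Set.Icc_subset_Icc le_rfl (by linarith [pi_pos]))

theorem continuous_sin_mul_log_two_sub_two_mul_cos :
    Continuous fun t ↦ sin t * log (2 - 2 * cos t) := by
  have heq : (fun t ↦ sin t * log (2 - 2 * cos t)) =
      fun t ↦ 2 * cos (t / 2) * (2 * sin (t / 2) * log (2 * sin (t / 2))) := by
    ext t
    obtain ⟨u, rfl⟩ : ∃ u, t = 2 * u := ⟨t / 2, by ring⟩
    rw [mul_div_cancel_left₀ _ two_ne_zero, sin_two_mul,
      show 2 - 2 * cos (2 * u) = (2 * sin u) ^ 2 by rw [cos_two_mul, mul_pow, sin_sq]; ring,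
      log_pow]
    push_cast
    ring
  rw [heq]
  exact Continuous.mul (by fun_prop)
    (continuous_mul_log.comp (f := fun t ↦ 2 * sin (t / 2)) (by fun_prop))

theorem integral_log_two_sub_two_mul_cos_mul_cos :
    ∫ t in 0..π, log (2 - 2 * cos t) * cos t = -π := by
  have hderiv : ∀ t ∈ Set.Ioo 0 π,
      HasDerivAt (fun t ↦ sin t * log (2 - 2 * cos t) - t - sin t)
        (log (2 - 2 * cos t) * cos t) t := by
    intro t ht
    have hsin := sin_pos_of_pos_of_lt_pi ht.1 ht.2
    have hcos : 0 < 1 - cos t := by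
      nlinarith [sin_sq_add_cos_sq t, cos_le_one t, neg_one_le_cos t, sq_pos_of_pos hsin]
    have hlog := (((hasDerivAt_cos t).const_mul 2).const_sub 2).log
      (by linarith : 2 - 2 * cos t ≠ 0)
    refine (((hasDerivAt_sin t).mul hlog).sub (hasDerivAt_id t)).sub (hasDerivAt_sin t)
      |>.congr_deriv ?_
    have hdiv : sin t * (-(2 * -sin t) / (2 - 2 * cos t)) = 1 + cos t := by
      rw [mul_div_assoc', div_eq_iff (by linarith)]
      nlinarith [sin_sq_add_cos_sq t]
    rw [hdiv]
    ring
  rw [intervalIntegral.integral_eq_sub_of_hasDerivAt_of_le pi_pos.le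
    ((continuous_sin_mul_log_two_sub_two_mul_cos.sub continuous_id).sub
      continuous_sin).continuousOn hderiv
    (intervalIntegrable_log_two_sub_two_mul_cos_zero_pi.mul_continuousOn
      continuous_cos.continuousOn)]
  simp

open MeasureTheory in
theorem integral_log_mul_poisson_cos_of_le_one {s : ℝ} (hs0 : 0 ≤ s) (hs1 : s ≤ 1) (c : ℝ) :
    IntervalIntegrable (fun t ↦ (c + log (2 - 2 * cos t)) *
        ((1 - s ^ 2) / (1 + s ^ 2 + 2 * s * cos t))) volume 0 π ∧
      (1 - s ^ 2) * (∫ t in 0..π, (c + log (2 - 2 * cos t)) *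
        ((1 - s ^ 2) / (1 + s ^ 2 + 2 * s * cos t)))
        = (1 - s ^ 2) * (c * π + 2 * π * log (1 + s)) := by
  rcases hs1.eq_or_lt with rfl | hs1
  · simp
  have hK := continuous_poisson_cos hs0 hs1
  have hcK : IntervalIntegrable
      (fun t ↦ c * ((1 - s ^ 2) / (1 + s ^ 2 + 2 * s * cos t))) volume 0 π :=
    (hK.intervalIntegrable _ _).const_mul c
  have hgK := intervalIntegrable_log_two_sub_two_mul_cos_zero_pi.mul_continuousOn hK.continuousOn
  simp only [add_mul]
  refine ⟨hcK.add hgK, ?_⟩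
  rw [intervalIntegral.integral_add hcK hgK, intervalIntegral.integral_const_mul,
    integral_poisson_cos hs0 hs1, integral_log_mul_poisson_cos hs0 hs1]

theorem integral_log_mul_affine_cos (a b c : ℝ) :
    ∫ t in 0..π, (c + log (2 - 2 * cos t)) * (a + b * cos t) = c * a * π - b * π := by
  have h1 : IntervalIntegrable (fun t ↦ c * (a + b * cos t)) MeasureTheory.volume 0 π :=
    Continuous.intervalIntegrable (by fun_prop) _ _
  have h2 := intervalIntegrable_log_two_sub_two_mul_cos_zero_pi.const_mul a
  have h3 := (intervalIntegrable_log_two_sub_two_mul_cos_zero_pi.mul_continuousOn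
    continuous_cos.continuousOn).const_mul b
  have heq : ∀ t, (c + log (2 - 2 * cos t)) * (a + b * cos t) = c * (a + b * cos t) +
      (a * log (2 - 2 * cos t) + b * (log (2 - 2 * cos t) * cos t)) := fun t ↦ by ring
  simp only [heq]
  rw [intervalIntegral.integral_add h1 (h2.add h3), intervalIntegral.integral_add h2 h3,
    intervalIntegral.integral_const_mul, intervalIntegral.integral_const_mul,
    intervalIntegral.integral_const_mul, integral_log_two_sub_two_mul_cos,
    integral_log_two_sub_two_mul_cos_mul_cos,
    intervalIntegral.integral_add (by simp) (Continuous.intervalIntegrable (by fun_prop) _ _)]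
  simp
  ring

open MeasureTheory in
theorem integral_eq_integral_affine_cos (f : ℝ → ℝ) {a : ℝ} (ha : 0 < a) (b : ℝ) :
    ∫ x in (b - a)..(b + a), f x = ∫ t in 0..π, a * sin t * f (a * cos t + b) := by
  have himage : (fun t ↦ a * cos t + b) '' Set.Icc 0 π = Set.Icc (b - a) (b + a) := by
    rw [← Set.image_image (fun y ↦ a * y + b) cos, bijOn_cos.image_eq, Set.image_affine_Icc' ha]
    congr 1 <;> ring
  have hinj : Set.InjOn (fun t ↦ a * cos t + b) (Set.Icc 0 π) := fun t ht u hu h ↦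
    injOn_cos ht hu (mul_left_cancel₀ ha.ne' (add_right_cancel h))
  have hderiv : ∀ t ∈ Set.Icc 0 π,
      HasDerivWithinAt (fun t ↦ a * cos t + b) (a * -sin t) (Set.Icc 0 π) t := fun t _ ↦
    (((hasDerivAt_cos t).const_mul a).add_const b).hasDerivWithinAt
  rw [intervalIntegral.integral_of_le (by linarith), intervalIntegral.integral_of_le pi_pos.le,
    ← integral_Icc_eq_integral_Ioc, ← integral_Icc_eq_integral_Ioc, ← himage,
    integral_image_eq_integral_abs_deriv_smul measurableSet_Icc hderiv hinj]
  refine setIntegral_congr_fun measurableSet_Icc fun t ht ↦ ?_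
  simp only [smul_eq_mul]
  rw [mul_neg, abs_neg, abs_of_nonneg (mul_nonneg ha.le (sin_nonneg_of_mem_Icc ht))]

/-- The Marčenko–Pastur integrand after the substitution `x = 1 + s² + 2 s cos t`. -/
theorem marchenko_pastur_integrand_cos {s t : ℝ} (hs0 : 0 < s)
    (ht : t ∈ Set.Ioo 0 π) :
    2 * s * sin t * (log ((1 + s) ^ 2 - (2 * s * cos t + (1 + s ^ 2))) *
        (√(((1 + s) ^ 2 - (2 * s * cos t + (1 + s ^ 2))) *
          (2 * s * cos t + (1 + s ^ 2) - (1 - s) ^ 2)) /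
          (2 * π * s ^ 2 * (2 * s * cos t + (1 + s ^ 2))))) =
      2 / π * ((log s + log (2 - 2 * cos t)) *
        ((1 + s ^ 2) / (4 * s ^ 2) + -1 / (2 * s) * cos t) -
        (1 - s ^ 2) / (4 * s ^ 2) * ((log s + log (2 - 2 * cos t)) *
          ((1 - s ^ 2) / (1 + s ^ 2 + 2 * s * cos t)))) := by
  have hsin := sin_pos_of_pos_of_lt_pi ht.1 ht.2
  have hsq := sin_sq_add_cos_sq t
  have hcos : 0 < 1 - cos t := by nlinarith [cos_le_one t, neg_one_le_cos t]
  have hcos' : 0 < 1 + cos t := by nlinarith [cos_le_one t, neg_one_le_cos t]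
  have hD : 0 < 1 + s ^ 2 + 2 * s * cos t := by nlinarith [mul_pos hs0 hcos', sq_nonneg (1 - s)]
  have hlog : log ((1 + s) ^ 2 - (2 * s * cos t + (1 + s ^ 2))) =
      log s + log (2 - 2 * cos t) := by
    rw [← log_mul hs0.ne' (by linarith)]
    congr 1
    ring
  have hsqrt : √(((1 + s) ^ 2 - (2 * s * cos t + (1 + s ^ 2))) *
      (2 * s * cos t + (1 + s ^ 2) - (1 - s) ^ 2)) = 2 * s * sin t := by
    rw [sqrt_eq_iff_mul_self_eq (by nlinarith [mul_pos (mul_pos hs0 hs0) (mul_pos hcos hcos')])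
      (by positivity)]
    linear_combination -4 * s ^ 2 * hsq
  rw [hlog, hsqrt, show 2 * s * cos t + (1 + s ^ 2) = 1 + s ^ 2 + 2 * s * cos t by ring]
  generalize log s + log (2 - 2 * cos t) = L
  have hD' := hD.ne'
  have hpi := pi_ne_zero
  have hsin2 : sin t ^ 2 = 1 - cos t ^ 2 := by linarith
  field_simp
  rw [hsin2]
  ring

/-- For `0 < λ ≤ 1`, with `d₊ = (1+√λ)²`, `d₋ = (1-√λ)²` and `p` the
Marčenko–Pastur density, `∫_{d₋}^{d₊} log(d₊-x) p(x) dx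
  = (1 - λ⁻¹) log(1+√λ) + log √λ + λ^{-1/2}`. -/
theorem mp_log_integral (l : ℝ) (hl0 : 0 < l) (hl1 : l ≤ 1) :
    (∫ x in ((1 - Real.sqrt l) ^ 2)..((1 + Real.sqrt l) ^ 2),
        Real.log ((1 + Real.sqrt l) ^ 2 - x) *
          (Real.sqrt (((1 + Real.sqrt l) ^ 2 - x) * (x - (1 - Real.sqrt l) ^ 2)) /
            (2 * Real.pi * l * x)))
      = (1 - l⁻¹) * Real.log (1 + Real.sqrt l) + Real.log (Real.sqrt l)
          + l ^ (-(1 : ℝ) / 2) := by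
  obtain ⟨s, hs0, rfl⟩ : ∃ s : ℝ, 0 < s ∧ s ^ 2 = l := ⟨√l, sqrt_pos.2 hl0, sq_sqrt hl0.le⟩
  have hs1 : s ≤ 1 := by nlinarith
  have hpow : (s ^ 2) ^ (-(1 : ℝ) / 2) = s⁻¹ := by
    rw [neg_div, rpow_neg (by positivity), ← sqrt_eq_rpow, sqrt_sq hs0.le]
  rw [hpow, sqrt_sq hs0.le]
  obtain ⟨hint, hval⟩ := integral_log_mul_poisson_cos_of_le_one hs0.le hs1 (log s)
  have hlower : (1 - s) ^ 2 = 1 + s ^ 2 - 2 * s := by ring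
  have hupper : (1 + s) ^ 2 = 1 + s ^ 2 + 2 * s := by ring
  have hsubst := integral_eq_integral_affine_cos (fun x ↦ log ((1 + s) ^ 2 - x) *
    (√(((1 + s) ^ 2 - x) * (x - (1 - s) ^ 2)) / (2 * π * s ^ 2 * x)))
    (mul_pos two_pos hs0) (1 + s ^ 2)
  rw [← hlower, ← hupper] at hsubst
  have haffine : IntervalIntegrable (fun t ↦ (log s + log (2 - 2 * cos t)) *
      ((1 + s ^ 2) / (4 * s ^ 2) + -1 / (2 * s) * cos t)) MeasureTheory.volume 0 π :=
    (intervalIntegrable_const.add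
      intervalIntegrable_log_two_sub_two_mul_cos_zero_pi).mul_continuousOn
      (Continuous.continuousOn (by fun_prop))
  rw [hsubst, intervalIntegral.integral_of_le pi_pos.le,
    MeasureTheory.integral_Ioc_eq_integral_Ioo,
    MeasureTheory.setIntegral_congr_fun measurableSet_Ioo
      fun t ht ↦ marchenko_pastur_integrand_cos hs0 ht,
    ← MeasureTheory.integral_Ioc_eq_integral_Ioo, ← intervalIntegral.integral_of_le pi_pos.le,
    intervalIntegral.integral_const_mul,
    intervalIntegral.integral_sub haffine (hint.const_mul _),
    intervalIntegral.integral_const_mul, integral_log_mul_affine_cos,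
    div_mul_eq_mul_div (1 - s ^ 2), hval]
  have hpi := pi_ne_zero
  field_simp
  ring
end

section
/- Fix 0 < λ ≤ 1 and let β_c = √(1+λ)/λ^{1/4}. With B = β/√(λ(1+λ)), α = (1−λ)/(2λ), and γ̃(β) = (1+λ)/β² + 1 + λ + λβ²/(1+λ), the discriminant of the deterministic saddle-point Hessian satisfies D_∞(β) = 4β⁴/(λ²(β_c⁴ − β⁴)) for 0 < β < β_c, where D_∞ is computed from the formula D_∞ = ∂₁²G_∞ · ∂₂²G_∞ − (∂₁∂₂G_∞)² evaluated at the critical point (γ̃₁, γ̃₂) with γ̃₁ = (α + √(α² + γ̃B²))/(2B), γ̃₂ = (−α + √(α² + γ̃B²))/(2B), and G_∞(z₁,z₂) = B(z₁+z₂) − α log z₁ − (1/2)∫ log(4z₁z₂ − x) p(x) dx. -/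
open Real

/-- Marčenko–Pastur density. -/
noncomputable def pMP (l x : ℝ) : ℝ :=
  Real.sqrt (((1 + Real.sqrt l) ^ 2 - x) * (x - (1 - Real.sqrt l) ^ 2)) /
    (2 * Real.pi * l * x)

/-- Deterministic exponent `G_∞(z₁,z₂) = B(z₁+z₂) - α log z₁ - ½∫log(4z₁z₂-x)p(x)dx`. -/
noncomputable def Ginf (l B al z₁ z₂ : ℝ) : ℝ :=
  B * (z₁ + z₂) - al * Real.log z₁ -
    (1 / 2) * ∫ x in ((1 - Real.sqrt l) ^ 2)..((1 + Real.sqrt l) ^ 2),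
      Real.log (4 * z₁ * z₂ - x) * pMP l x

/-- `γ̃(β)` in closed form. -/
noncomputable def gammaTilde (l β : ℝ) : ℝ := (1 + l) / β ^ 2 + 1 + l + l * β ^ 2 / (1 + l)

section PoissonKernel

lemma poissonDenom_pos {θ : ℝ} (q : ℝ) (hθ : θ ∈ Set.Ioo 0 π) :
    0 < 1 - 2 * q * cos θ + q ^ 2 := by
  have hs := sin_pos_of_pos_of_lt_pi hθ.1 hθ.2
  nlinarith [sin_sq_add_cos_sq θ, sq_nonneg (q - cos θ), pow_pos hs 2]

lemma poissonDenom_pos_of_lt {q : ℝ} (θ : ℝ) (hq : q ^ 2 < 1) :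
    0 < 1 - 2 * q * cos θ + q ^ 2 := by
  have h1 : |q| < 1 := (sq_lt_one_iff_abs_lt_one q).1 hq
  have h2 : q * cos θ ≤ |q| := by
    calc q * cos θ ≤ |q * cos θ| := le_abs_self _
      _ = |q| * |cos θ| := abs_mul _ _
      _ ≤ |q| * 1 := by gcongr; exact abs_cos_le_one θ
      _ = |q| := mul_one _
  nlinarith [sq_abs q]

lemma integral_poissonKernel {q : ℝ} (hq : q ^ 2 < 1) :
    ∫ θ in (0 : ℝ)..π, (1 - q ^ 2) / (1 - 2 * q * cos θ + q ^ 2) = π := by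
  have hpos := fun θ => poissonDenom_pos_of_lt θ hq
  have hne : ∀ θ, 1 - q * cos θ ≠ 0 := by
    intro θ h
    nlinarith [hpos θ]
  have hderiv : ∀ θ ∈ Set.uIcc 0 π,
      HasDerivAt (fun θ => θ + 2 * arctan (q * sin θ / (1 - q * cos θ)))
        ((1 - q ^ 2) / (1 - 2 * q * cos θ + q ^ 2)) θ := by
    intro θ _
    have h1 : HasDerivAt (fun θ => q * sin θ / (1 - q * cos θ)) _ θ :=
      ((hasDerivAt_sin θ).const_mul q).div (((hasDerivAt_cos θ).const_mul q).const_sub 1) (hne θ)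
    have h2 := (hasDerivAt_id θ).add (h1.arctan.const_mul 2)
    refine h2.congr_deriv ?_
    have h3 := (hpos θ).ne'
    have h4 := hne θ
    have hd : 1 + (q * sin θ / (1 - q * cos θ)) ^ 2 =
        (1 - 2 * q * cos θ + q ^ 2) / (1 - q * cos θ) ^ 2 := by
      field_simp
      linear_combination q ^ 2 * sin_sq_add_cos_sq θ
    rw [hd]
    field_simp
    linear_combination (-2 * q ^ 2) * sin_sq_add_cos_sq θ
  rw [intervalIntegral.integral_eq_sub_of_hasDerivAt hderiv]
  · simp
  · refine Continuous.intervalIntegrable ?_ _ _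
    exact continuous_const.div (by fun_prop) fun θ => (hpos θ).ne'

lemma integral_sin_sq_div_poissonDenom {q : ℝ} (hq0 : q ≠ 0) (hq : q ^ 2 ≤ 1) :
    ∫ θ in (0 : ℝ)..π, sin θ ^ 2 / (1 - 2 * q * cos θ + q ^ 2) = π / 2 := by
  have hcongr : ∫ θ in (0 : ℝ)..π, sin θ ^ 2 / (1 - 2 * q * cos θ + q ^ 2) =
      ∫ θ in (0 : ℝ)..π, ((1 + q ^ 2 + 2 * q * cos θ) / (4 * q ^ 2) -
        (1 - q ^ 2) / (4 * q ^ 2) * ((1 - q ^ 2) / (1 - 2 * q * cos θ + q ^ 2))) := by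
    rw [intervalIntegral.integral_of_le pi_pos.le, intervalIntegral.integral_of_le pi_pos.le,
      MeasureTheory.integral_Ioc_eq_integral_Ioo, MeasureTheory.integral_Ioc_eq_integral_Ioo]
    refine MeasureTheory.setIntegral_congr_fun measurableSet_Ioo fun θ hθ => ?_
    have h := (poissonDenom_pos q hθ).ne'
    field_simp
    linear_combination 4 * q ^ 2 * sin_sq_add_cos_sq θ
  have hint : IntervalIntegrable (fun θ => (1 - q ^ 2) / (4 * q ^ 2) *
      ((1 - q ^ 2) / (1 - 2 * q * cos θ + q ^ 2))) MeasureTheory.volume 0 π := by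
    rcases hq.eq_or_lt with h | h
    · simp [h]
    · refine Continuous.intervalIntegrable ?_ _ _
      exact continuous_const.mul
        (continuous_const.div (by fun_prop) fun θ => (poissonDenom_pos_of_lt θ h).ne')
  have hsecond : ∫ θ in (0 : ℝ)..π, (1 - q ^ 2) / (4 * q ^ 2) *
      ((1 - q ^ 2) / (1 - 2 * q * cos θ + q ^ 2)) = (1 - q ^ 2) / (4 * q ^ 2) * π := by
    rcases hq.eq_or_lt with h | h
    · simp [h]
    · rw [intervalIntegral.integral_const_mul, integral_poissonKernel h]
  have hfirst : ∫ θ in (0 : ℝ)..π, (1 + q ^ 2 + 2 * q * cos θ) / (4 * q ^ 2) =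
      (1 + q ^ 2) / (4 * q ^ 2) * π := by
    rw [intervalIntegral.integral_div, intervalIntegral.integral_add (by simp)
      (Continuous.intervalIntegrable (by fun_prop) _ _), intervalIntegral.integral_const_mul]
    simp
    ring
  rw [hcongr, intervalIntegral.integral_sub
    (Continuous.intervalIntegrable (by fun_prop) _ _) hint, hfirst, hsecond]
  field_simp
  ring

end PoissonKernel

section MarchenkoPastur

/-- The Marčenko–Pastur point with angular coordinate `θ`. -/
noncomputable def mpPoint (l θ : ℝ) : ℝ := 1 + l + 2 * √l * cos θ

/-- The Marčenko–Pastur density in the angular coordinate. -/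
noncomputable def mpWeight (l θ : ℝ) : ℝ := 2 * sin θ ^ 2 / (π * mpPoint l θ)

/-- The logarithmic potential of the Marčenko–Pastur law. -/
noncomputable def mpLogPotential (l z : ℝ) : ℝ :=
  ∫ x in ((1 - √l) ^ 2)..((1 + √l) ^ 2), log (z - x) * pMP l x

/-- The larger root `u` of `u + l / u = z - 1 - l`. -/
noncomputable def mpRoot (l z : ℝ) : ℝ := (z - 1 - l + √((z - 1 - l) ^ 2 - 4 * l)) / 2

lemma continuous_mpPoint (l : ℝ) : Continuous (mpPoint l) := by
  unfold mpPoint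
  fun_prop

lemma mpPoint_le (l θ : ℝ) (hl : 0 ≤ l) : mpPoint l θ ≤ (1 + √l) ^ 2 := by
  unfold mpPoint
  nlinarith [cos_le_one θ, sqrt_nonneg l, sq_sqrt hl]

lemma sin_sq_le_mpPoint (l θ : ℝ) (hl : 0 ≤ l) : sin θ ^ 2 ≤ mpPoint l θ := by
  unfold mpPoint
  nlinarith [sin_sq_add_cos_sq θ, sq_nonneg (√l + cos θ), sq_sqrt hl]

lemma norm_mpWeight_le (l θ : ℝ) (hl : 0 ≤ l) : ‖mpWeight l θ‖ ≤ 2 := by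
  have h := sin_sq_le_mpPoint l θ hl
  have h0 : 0 ≤ mpPoint l θ := (sq_nonneg _).trans h
  unfold mpWeight
  rw [norm_of_nonneg (by positivity)]
  refine div_le_of_le_mul₀ (by positivity) (by norm_num) ?_
  nlinarith [pi_gt_three]

lemma measurable_mpWeight (l : ℝ) : Measurable (mpWeight l) := by
  have := (continuous_mpPoint l).measurable
  unfold mpWeight
  fun_prop

lemma intervalIntegrable_mpWeight {l : ℝ} (hl : 0 ≤ l) :
    IntervalIntegrable (mpWeight l) MeasureTheory.volume 0 π :=
  (intervalIntegrable_const (c := (2 : ℝ))).mono_fun (measurable_mpWeight l).aestronglyMeasurable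
    (Filter.Eventually.of_forall fun θ => by simpa using norm_mpWeight_le l θ hl)

lemma image_mpPoint {l : ℝ} (hl : 0 < l) :
    mpPoint l '' Set.Icc 0 π = Set.Icc ((1 - √l) ^ 2) ((1 + √l) ^ 2) := by
  have hs := sqrt_pos.2 hl
  have hsq := sq_sqrt hl.le
  ext x
  constructor
  · rintro ⟨θ, -, rfl⟩
    refine ⟨?_, mpPoint_le l θ hl.le⟩
    unfold mpPoint
    nlinarith [neg_one_le_cos θ]
  · rintro ⟨h1, h2⟩
    refine ⟨arccos ((x - 1 - l) / (2 * √l)), ⟨arccos_nonneg _, arccos_le_pi _⟩, ?_⟩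
    unfold mpPoint
    rw [cos_arccos]
    · field_simp
      ring
    · rw [le_div_iff₀ (by positivity)]
      nlinarith
    · rw [div_le_iff₀ (by positivity)]
      nlinarith

lemma injOn_mpPoint {l : ℝ} (hl : 0 < l) : Set.InjOn (mpPoint l) (Set.Icc 0 π) := by
  intro x hx y hy h
  have hs := sqrt_pos.2 hl
  refine injOn_cos hx hy (mul_left_cancel₀ (mul_pos two_pos hs).ne' ?_)
  simpa [mpPoint] using h

lemma integral_mul_pMP {l : ℝ} (hl : 0 < l) (f : ℝ → ℝ) :
    ∫ x in ((1 - √l) ^ 2)..((1 + √l) ^ 2), f x * pMP l x =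
      ∫ θ in (0 : ℝ)..π, f (mpPoint l θ) * mpWeight l θ := by
  have hs := sqrt_pos.2 hl
  have hsq := sq_sqrt hl.le
  rw [intervalIntegral.integral_of_le (by nlinarith), intervalIntegral.integral_of_le pi_pos.le,
    ← MeasureTheory.integral_Icc_eq_integral_Ioc, ← MeasureTheory.integral_Icc_eq_integral_Ioc,
    ← image_mpPoint hl, MeasureTheory.integral_image_eq_integral_abs_deriv_smul measurableSet_Icc
      (f' := fun θ => 2 * √l * -sin θ) _ (injOn_mpPoint hl)]
  · refine MeasureTheory.setIntegral_congr_fun measurableSet_Icc fun θ hθ => ?_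
    have hsin := sin_nonneg_of_nonneg_of_le_pi hθ.1 hθ.2
    have hroot : ((1 + √l) ^ 2 - mpPoint l θ) * (mpPoint l θ - (1 - √l) ^ 2) =
        (2 * √l * sin θ) ^ 2 := by
      unfold mpPoint
      linear_combination (4 * √l * cos θ - (√l ^ 2 - l)) * hsq -
        4 * √l ^ 2 * sin_sq_add_cos_sq θ
    simp only [pMP, mpWeight, smul_eq_mul, hroot]
    rw [sqrt_sq (by positivity), mul_neg, abs_neg, abs_of_nonneg (by positivity)]
    have hl4 : (2 * √l * sin θ) * (2 * √l * sin θ) = 4 * l * sin θ ^ 2 := by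
      linear_combination 4 * sin θ ^ 2 * hsq
    calc 2 * √l * sin θ * (f (mpPoint l θ) * (2 * √l * sin θ / (2 * π * l * mpPoint l θ)))
        = f (mpPoint l θ) * (((2 * √l * sin θ) * (2 * √l * sin θ)) /
            (2 * π * l * mpPoint l θ)) := by ring
      _ = f (mpPoint l θ) * ((2 * l) * (2 * sin θ ^ 2) / ((2 * l) * (π * mpPoint l θ))) := by
          rw [hl4]
          ring_nf
      _ = _ := by rw [mul_div_mul_left _ _ (by positivity)]
  · intro θ _
    exact (((hasDerivAt_cos θ).const_mul (2 * √l)).const_add (1 + l)).hasDerivWithinAt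

lemma mpPoint_mpRoot {l z : ℝ} (hl : 0 < l) (hz : (1 + √l) ^ 2 < z) :
    √l < mpRoot l z ∧ z - 1 - l = mpRoot l z + l / mpRoot l z ∧
      √((z - 1 - l) ^ 2 - 4 * l) = mpRoot l z - l / mpRoot l z := by
  have hs := sqrt_pos.2 hl
  have hsq := sq_sqrt hl.le
  have hz' : 2 * √l < z - 1 - l := by nlinarith
  have hdisc : 0 < (z - 1 - l) ^ 2 - 4 * l := by nlinarith
  have hroot := sq_sqrt hdisc.le
  have hroot0 := sqrt_pos.2 hdisc
  have hlt : √l < mpRoot l z := by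
    unfold mpRoot
    linarith
  have hu : 0 < mpRoot l z := hs.trans hlt
  have hprod : l / mpRoot l z = (z - 1 - l - √((z - 1 - l) ^ 2 - 4 * l)) / 2 := by
    rw [div_eq_iff hu.ne']
    unfold mpRoot
    linear_combination hroot / 4
  refine ⟨hlt, ?_, ?_⟩ <;> rw [hprod] <;> unfold mpRoot <;> ring

lemma integral_mpWeight_div {l z : ℝ} (hl0 : 0 < l) (hl1 : l ≤ 1) (hz : (1 + √l) ^ 2 < z) :
    ∫ θ in (0 : ℝ)..π, 1 / (z - mpPoint l θ) * mpWeight l θ = 1 / (mpRoot l z + l) := by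
  obtain ⟨hu, hzu, -⟩ := mpPoint_mpRoot hl0 hz
  set u := mpRoot l z
  have hs := sqrt_pos.2 hl0
  have hsq := sq_sqrt hl0.le
  have hu0 : 0 < u := hs.trans hu
  have hz0 : 0 < z := lt_of_le_of_lt (sq_nonneg _) hz
  have hq : (√l / u) ^ 2 < 1 := by
    rw [sq_lt_one_iff_abs_lt_one, abs_of_pos (by positivity), div_lt_one hu0]
    exact hu
  have hpoint : ∀ θ, mpPoint l θ = 1 - 2 * (-√l) * cos θ + (-√l) ^ 2 := by
    intro θ
    unfold mpPoint
    linear_combination -hsq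
  have hsub : ∀ θ, z - mpPoint l θ = u * (1 - 2 * (√l / u) * cos θ + (√l / u) ^ 2) := by
    intro θ
    have hlu : u * (√l / u) ^ 2 = l / u := by
      field_simp
      exact hsq
    have hsu : u * (√l / u) = √l := by field_simp
    unfold mpPoint
    linear_combination hzu - hlu + 2 * cos θ * hsu
  have hsplit : ∀ θ ∈ Set.Ioo 0 π, 1 / (z - mpPoint l θ) * mpWeight l θ =
      2 / (π * z) * (sin θ ^ 2 / (1 - 2 * (-√l) * cos θ + (-√l) ^ 2)) +
      2 / (π * z * u) * (sin θ ^ 2 / (1 - 2 * (√l / u) * cos θ + (√l / u) ^ 2)) := by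
    intro θ hθ
    have hx : 0 < mpPoint l θ :=
      (pow_pos (sin_pos_of_pos_of_lt_pi hθ.1 hθ.2) 2).trans_le (sin_sq_le_mpPoint l θ hl0.le)
    have hd := poissonDenom_pos_of_lt θ hq
    have hd' := hsub θ
    unfold mpWeight
    rw [← hpoint]
    set d := 1 - 2 * (√l / u) * cos θ + (√l / u) ^ 2
    rw [hd']
    have hz' : z = mpPoint l θ + u * d := by linarith
    have := pi_pos
    field_simp
    linear_combination sin θ ^ 2 * hz'
  have hint1 : IntervalIntegrable (fun θ => 2 / (π * z) *
      (sin θ ^ 2 / (1 - 2 * (-√l) * cos θ + (-√l) ^ 2))) MeasureTheory.volume 0 π := by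
    refine ((intervalIntegrable_mpWeight hl0.le).const_mul (1 / z)).congr ?_
    refine fun θ _ => ?_
    simp only [mpWeight, ← hpoint]
    ring
  have hint2 : IntervalIntegrable (fun θ => 2 / (π * z * u) *
      (sin θ ^ 2 / (1 - 2 * (√l / u) * cos θ + (√l / u) ^ 2))) MeasureTheory.volume 0 π := by
    refine Continuous.intervalIntegrable ?_ _ _
    exact continuous_const.mul
      (Continuous.div (by fun_prop) (by fun_prop) fun θ => (poissonDenom_pos_of_lt θ hq).ne')
  have hcongr : ∫ θ in (0 : ℝ)..π, 1 / (z - mpPoint l θ) * mpWeight l θ =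
      ∫ θ in (0 : ℝ)..π,
        (2 / (π * z) * (sin θ ^ 2 / (1 - 2 * (-√l) * cos θ + (-√l) ^ 2)) +
        2 / (π * z * u) * (sin θ ^ 2 / (1 - 2 * (√l / u) * cos θ + (√l / u) ^ 2))) := by
    rw [intervalIntegral.integral_of_le pi_pos.le, intervalIntegral.integral_of_le pi_pos.le,
      MeasureTheory.integral_Ioc_eq_integral_Ioo, MeasureTheory.integral_Ioc_eq_integral_Ioo]
    exact MeasureTheory.setIntegral_congr_fun measurableSet_Ioo hsplit
  rw [hcongr, intervalIntegral.integral_add hint1 hint2, intervalIntegral.integral_const_mul,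
    intervalIntegral.integral_const_mul,
    integral_sin_sq_div_poissonDenom (neg_ne_zero.2 hs.ne') (by rw [neg_sq, hsq]; exact hl1),
    integral_sin_sq_div_poissonDenom (by positivity) hq.le]
  have hz' : z = (u + 1) * (u + l) / u := by
    field_simp at hzu ⊢
    linear_combination hzu
  rw [hz']
  have := pi_pos
  field_simp

lemma hasDerivAt_mpLogPotential {l z : ℝ} (hl0 : 0 < l) (hl1 : l ≤ 1) (hz : (1 + √l) ^ 2 < z) :
    HasDerivAt (mpLogPotential l) (1 / (mpRoot l z + l)) z := by
  have heq : mpLogPotential l = fun z => ∫ θ in (0 : ℝ)..π,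
      log (z - mpPoint l θ) * mpWeight l θ :=
    funext fun z => integral_mul_pMP hl0 fun x => log (z - x)
  rw [heq, ← integral_mpWeight_div hl0 hl1 hz]
  have hp := (continuous_mpPoint l).measurable
  have hw := measurable_mpWeight l
  obtain ⟨c, hc, hcz⟩ := exists_between hz
  have hpos : ∀ y ∈ Set.Ioi c, ∀ θ, c - (1 + √l) ^ 2 < y - mpPoint l θ := fun y hy θ => by
    have := mpPoint_le l θ hl0.le
    have : c < y := hy
    linarith
  have hδ : 0 < c - (1 + √l) ^ 2 := sub_pos.2 hc
  refine (intervalIntegral.hasDerivAt_integral_of_dominated_loc_of_deriv_le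
    (s := Set.Ioi c) (bound := fun _ => 1 / (c - (1 + √l) ^ 2) * 2)
    (F' := fun y θ => 1 / (y - mpPoint l θ) * mpWeight l θ)
    (Ioi_mem_nhds hcz) ?_ ?_ ?_ ?_ intervalIntegrable_const ?_).2
  · refine Filter.Eventually.of_forall fun y => Measurable.aestronglyMeasurable ?_
    fun_prop
  · refine (intervalIntegrable_mpWeight hl0.le).continuousOn_mul
      (Continuous.continuousOn ?_)
    exact (continuous_const.sub (continuous_mpPoint l)).log
      fun θ => (hδ.trans (hpos z hcz θ)).ne'
  · refine Measurable.aestronglyMeasurable ?_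
    fun_prop
  · refine Filter.Eventually.of_forall fun θ _ y hy => ?_
    have h := hpos y hy θ
    rw [norm_mul, norm_of_nonneg (one_div_nonneg.2 (hδ.trans h).le)]
    gcongr
    exact norm_mpWeight_le l θ hl0.le
  · refine Filter.Eventually.of_forall fun θ _ y hy => ?_
    exact (((hasDerivAt_id y).sub_const _).log (hδ.trans (hpos y hy θ)).ne').mul_const _

lemma hasDerivAt_one_div_mpRoot_add {l z : ℝ} (hl : 0 < l) (hz : (1 + √l) ^ 2 < z) :
    HasDerivAt (fun z => 1 / (mpRoot l z + l))
      (-(mpRoot l z ^ 2 / ((mpRoot l z + l) ^ 2 * (mpRoot l z ^ 2 - l)))) z := by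
  obtain ⟨hu, hzu, hroot⟩ := mpPoint_mpRoot hl hz
  have hs := sqrt_pos.2 hl
  have hsq := sq_sqrt hl.le
  have hu0 : 0 < mpRoot l z := hs.trans hu
  have hul : 0 < mpRoot l z ^ 2 - l := by nlinarith
  have hdisc : (z - 1 - l) ^ 2 - 4 * l ≠ 0 := by
    intro h
    rw [h, sqrt_zero] at hroot
    have : mpRoot l z - l / mpRoot l z = (mpRoot l z ^ 2 - l) / mpRoot l z := by field_simp
    rw [this] at hroot
    exact (div_pos hul hu0).ne hroot
  have hlin : HasDerivAt (fun z : ℝ => z - 1 - l) 1 z :=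
    ((hasDerivAt_id z).sub_const 1).sub_const l
  have hU : HasDerivAt (mpRoot l) (mpRoot l z ^ 2 / (mpRoot l z ^ 2 - l)) z := by
    refine ((hlin.add (((hlin.pow 2).sub_const (4 * l)).sqrt hdisc)).div_const 2).congr_deriv ?_
    simp only [Pi.pow_apply, Nat.cast_ofNat, Nat.add_one_sub_one, pow_one]
    rw [hroot, hzu]
    have : mpRoot l z - l / mpRoot l z = (mpRoot l z ^ 2 - l) / mpRoot l z := by field_simp
    rw [this]
    have hu1 := hu0.ne'
    have hul1 := hul.ne'
    generalize mpRoot l z = u at hu1 hul1 ⊢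
    field_simp
    ring
  have h := (hU.add_const l).inv (by positivity)
  simp only [one_div]
  refine h.congr_deriv ?_
  field_simp

end MarchenkoPastur

/-- The Hessian discriminant of `B * (x + y) - a * log x - Φ (4 * x * y) / 2` at a point
depends on `Φ` only through its first two derivatives at `4 * x * y`. -/
lemma hessian_discriminant_of_hasDerivAt {Φ m : ℝ → ℝ} {B a b x y m' : ℝ} {G : ℝ → ℝ → ℝ}
    (hG : ∀ x y, G x y = B * (x + y) - a * log x - 1 / 2 * Φ (4 * x * y))
    (hΦ : ∀ z, b < z → HasDerivAt Φ (m z) z) (hm : HasDerivAt m m' (4 * x * y))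
    (hx : 0 < x) (hb : b < 4 * x * y) :
    deriv (deriv fun z => G z y) x * deriv (deriv fun z => G x z) y -
        deriv (fun z₁ => deriv (fun z₂ => G z₁ z₂) y) x ^ 2 =
      -8 * a * m' - 4 * m (4 * x * y) ^ 2 - 8 * (4 * x * y) * m (4 * x * y) * m' := by
  have hlin1 : ∀ x y : ℝ, HasDerivAt (fun z => 4 * z * y) (4 * y) x := fun x y => by
    simpa using ((hasDerivAt_id x).const_mul 4).mul_const y
  have hlin2 : ∀ x y : ℝ, HasDerivAt (fun z => 4 * x * z) (4 * x) y := fun x y => by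
    simpa using (hasDerivAt_id y).const_mul (4 * x)
  have hG1 : ∀ z, 0 < z → b < 4 * z * y →
      HasDerivAt (fun z => G z y) (B - a * z⁻¹ - 2 * y * m (4 * z * y)) z := by
    intro z hz hbz
    have h := ((((hasDerivAt_id z).add_const y).const_mul B).sub
      ((hasDerivAt_log hz.ne').const_mul a)).sub
      (((hΦ _ hbz).comp z (hlin1 z y)).const_mul (1 / 2))
    refine (h.congr_deriv (by ring)).congr_of_eventuallyEq
      (Filter.Eventually.of_forall fun z => ?_)
    simp [hG]
  have hG2 : ∀ w z, b < 4 * w * z →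
      HasDerivAt (fun z => G w z) (B - 2 * w * m (4 * w * z)) z := by
    intro w z hbz
    have h := ((((hasDerivAt_id z).const_add w).const_mul B).sub_const (a * log w)).sub
      (((hΦ _ hbz).comp z (hlin2 w z)).const_mul (1 / 2))
    refine (h.congr_deriv (by ring)).congr_of_eventuallyEq
      (Filter.Eventually.of_forall fun z => ?_)
    simp [hG]
  have hev1 : ∀ᶠ z in nhds x, b < 4 * z * y :=
    (hlin1 x y).continuousAt.eventually_const_lt hb
  have hev2 : ∀ᶠ z in nhds y, b < 4 * x * z :=
    (hlin2 x y).continuousAt.eventually_const_lt hb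
  have hm1 : HasDerivAt (fun z => m (4 * z * y)) (m' * (4 * y)) x := hm.comp x (hlin1 x y)
  have hm2 : HasDerivAt (fun z => m (4 * x * z)) (m' * (4 * x)) y := hm.comp y (hlin2 x y)
  have h11 : deriv (deriv fun z => G z y) x = a / x ^ 2 - 8 * y ^ 2 * m' := by
    have hE : (deriv fun z => G z y) =ᶠ[nhds x]
        fun z => B - a * z⁻¹ - 2 * y * m (4 * z * y) := by
      filter_upwards [hev1, lt_mem_nhds hx] with z hz hz0 using (hG1 z hz0 hz).deriv
    have h := ((((hasDerivAt_inv hx.ne').const_mul a).const_sub B).sub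
      (hm1.const_mul (2 * y))).deriv
    rw [hE.deriv_eq]
    refine h.trans ?_
    ring
  have h22 : deriv (deriv fun z => G x z) y = -(8 * x ^ 2 * m') := by
    have hE : (deriv fun z => G x z) =ᶠ[nhds y] fun z => B - 2 * x * m (4 * x * z) := by
      filter_upwards [hev2] with z hz using (hG2 x z hz).deriv
    rw [hE.deriv_eq, ((hm2.const_mul (2 * x)).const_sub B).deriv]
    ring
  have h12 : deriv (fun z₁ => deriv (fun z₂ => G z₁ z₂) y) x =
      -(2 * m (4 * x * y) + 8 * x * y * m') := by
    have hE : (fun z₁ => deriv (fun z₂ => G z₁ z₂) y) =ᶠ[nhds x]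
        fun z => B - 2 * z * m (4 * z * y) := by
      filter_upwards [hev1] with z hz using (hG2 z y hz).deriv
    have h := ((((hasDerivAt_id x).const_mul 2).mul hm1).const_sub B).deriv
    rw [hE.deriv_eq]
    refine h.trans ?_
    simp only [id]
    ring
  rw [h11, h22, h12]
  field_simp
  ring

/-- the Hessian discriminant of `G_∞` at the deterministic critical
point `(γ̃₁, γ̃₂)` equals `4β⁴/(λ²(β_c⁴ - β⁴))` for `0 < β < β_c`. -/
theorem discriminant_Ginf (l β : ℝ) (hl0 : 0 < l) (hl1 : l ≤ 1) (hβ : 0 < β)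
    (hβc : β < Real.sqrt (1 + l) / l ^ ((1 : ℝ) / 4)) :
    let al : ℝ := (1 - l) / (2 * l)
    let B : ℝ := β / Real.sqrt (l * (1 + l))
    let γ : ℝ := gammaTilde l β
    let γ₁ : ℝ := (al + Real.sqrt (al ^ 2 + γ * B ^ 2)) / (2 * B)
    let γ₂ : ℝ := (-al + Real.sqrt (al ^ 2 + γ * B ^ 2)) / (2 * B)
    deriv (deriv (fun z => Ginf l B al z γ₂)) γ₁ *
        deriv (deriv (fun z => Ginf l B al γ₁ z)) γ₂ -
      (deriv (fun z₁ => deriv (fun z₂ => Ginf l B al z₁ z₂) γ₂) γ₁) ^ 2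
    = 4 * β ^ 4 /
        (l ^ 2 * ((Real.sqrt (1 + l) / l ^ ((1 : ℝ) / 4)) ^ 4 - β ^ 4)) := by
  intro al B γ γ₁ γ₂
  set u : ℝ := (1 + l) / β ^ 2 with hu_def
  have h1l : 0 < 1 + l := by linarith
  have hs := sqrt_pos.2 hl0
  have hsq := sq_sqrt hl0.le
  have hu0 : 0 < u := by positivity
  have hβc4 : (√(1 + l) / l ^ ((1 : ℝ) / 4)) ^ 4 = (1 + l) ^ 2 / l := by
    have h1 : √(1 + l) ^ 4 = (1 + l) ^ 2 := by
      rw [show √(1 + l) ^ 4 = (√(1 + l) ^ 2) ^ 2 by ring, sq_sqrt h1l.le]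
    have h2 : (l ^ ((1 : ℝ) / 4)) ^ 4 = l := by
      rw [← rpow_natCast, ← rpow_mul hl0.le]
      norm_num
    rw [div_pow, h1, h2]
  have hβ4 : β ^ 4 < (1 + l) ^ 2 / l := hβc4 ▸ pow_lt_pow_left₀ hβc hβ.le (by norm_num)
  have hul : l < u ^ 2 := by
    rw [lt_div_iff₀ hl0] at hβ4
    rw [hu_def, div_pow, lt_div_iff₀ (by positivity)]
    linarith
  have hsu : √l < u := (sqrt_lt' hu0).2 hul
  have hγu : γ = u + 1 + l + l / u := by
    simp only [γ, gammaTilde, hu_def]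
    field_simp
  have hγu' : γ - 1 - l = u + l / u := by rw [hγu]; ring
  have hγ : (1 + √l) ^ 2 < γ := by
    have h : γ - (1 + √l) ^ 2 = (u - √l) ^ 2 / u := by
      rw [hγu]
      field_simp
      linear_combination (-u - 1) * hsq
    have : 0 < (u - √l) ^ 2 / u := div_pos (pow_pos (sub_pos.2 hsu) 2) hu0
    linarith
  have hroot : mpRoot l γ = u := by
    have h : (γ - 1 - l) ^ 2 - 4 * l = (u - l / u) ^ 2 := by
      rw [hγu']
      field_simp
      ring
    have h' : 0 ≤ u - l / u := by
      rw [sub_nonneg, div_le_iff₀ hu0]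
      nlinarith
    rw [mpRoot, h, sqrt_sq h', hγu']
    ring
  have hγ0 : 0 < γ := lt_of_le_of_lt (sq_nonneg _) hγ
  have hB : 0 < B := div_pos hβ (sqrt_pos.2 (by positivity))
  have hal : 0 ≤ al := div_nonneg (by linarith) (by linarith)
  have hR : 0 < √(al ^ 2 + γ * B ^ 2) := sqrt_pos.2 (by positivity)
  have hγ₁ : 0 < γ₁ := div_pos (by linarith) (by linarith)
  have hprod : 4 * γ₁ * γ₂ = γ := by
    have hR2 := sq_sqrt (show 0 ≤ al ^ 2 + γ * B ^ 2 by positivity)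
    simp only [γ₁, γ₂]
    clear_value al B γ
    field_simp
    linear_combination 4 * hR2
  rw [hessian_discriminant_of_hasDerivAt (G := Ginf l B al) (Φ := mpLogPotential l)
    (m := fun z => 1 / (mpRoot l z + l)) (fun _ _ => rfl)
    (fun z hz => hasDerivAt_mpLogPotential hl0 hl1 hz)
    (hprod ▸ hasDerivAt_one_div_mpRoot_add hl0 hγ) hγ₁ (hprod ▸ hγ), hβc4]
  simp only [hprod, hroot]
  have hul' : u ^ 2 - l ≠ 0 := (sub_pos.2 hul).ne'
  have hlhs : -8 * al * -(u ^ 2 / ((u + l) ^ 2 * (u ^ 2 - l))) - 4 * (1 / (u + l)) ^ 2 -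
      8 * γ * (1 / (u + l)) * -(u ^ 2 / ((u + l) ^ 2 * (u ^ 2 - l))) =
      4 / (l * (u ^ 2 - l)) := by
    rw [hγu]
    simp only [al]
    field_simp
    ring
  have hrhs : l ^ 2 * ((1 + l) ^ 2 / l - β ^ 4) = l * (u ^ 2 - l) * β ^ 4 := by
    rw [hu_def]
    field_simp
  rw [hlhs, hrhs]
  field_simp
end
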